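/- arXiv:2211.03914 — 4 statements merged into one kernel-verified Lean document; each statement's English description precedes it below -/
import Mathlib

section
/- Let ξ < −1 be real and let z = u + iv be a complex number with 0 < v < u, and let φ = arg z ∈ (0, π/4). Then the phase θ(z) = ξ(z − z⁻¹) − (1/2)(z² − z⁻²) satisfies Re(2iθ(z)) ≥ v·sin(2φ) > 0. -/
/-- The phase function of the defocusing NLS Riemann–Hilbert problem:
`θ(z) = ξ(z − z⁻¹) − (1/2)(z² − z⁻²)`. -/
noncomputable def theta (ξ : ℝ) (z : ℂ) : ℂ :=
  (ξ : ℂ) * (z - z⁻¹) - (1 / 2) * (z ^ 2 - (z⁻¹) ^ 2)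

theorem re_two_I_mul_theta (ξ : ℝ) (z : ℂ) :
    (2 * Complex.I * theta ξ z).re =
      -2 * ξ * z.im * (1 + (Complex.normSq z)⁻¹) +
        2 * z.re * z.im * (1 + ((Complex.normSq z)⁻¹) ^ 2) := by
  simp only [theta, pow_two, Complex.mul_re, Complex.mul_im, Complex.sub_re, Complex.sub_im,
    Complex.inv_re, Complex.inv_im, Complex.I_re, Complex.I_im, Complex.ofReal_re,
    Complex.ofReal_im, Complex.re_ofNat, Complex.im_ofNat, Complex.normSq_ofNat,
    Complex.one_re, Complex.one_im, div_eq_mul_inv]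
  ring

theorem stmt_8 (ξ : ℝ) (hξ : ξ < -1) (z : ℂ)
    (hv : 0 < z.im) (hvu : z.im < z.re) :
    z.im * Real.sin (2 * Complex.arg z) ≤ (2 * Complex.I * theta ξ z).re ∧
    0 < z.im * Real.sin (2 * Complex.arg z) := by
  have hu : 0 < z.re := hv.trans hvu
  have hz : z ≠ 0 := fun h => by simp [h] at hv
  refine ⟨?_, mul_pos hv ?_⟩
  · rw [re_two_I_mul_theta]
    have hr : 0 < (Complex.normSq z)⁻¹ := inv_pos.mpr (Complex.normSq_pos.mpr hz)
    have hsin : z.im * Real.sin (2 * Complex.arg z) ≤ z.im * 1 :=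
      mul_le_mul_of_nonneg_left (Real.sin_le_one _) hv.le
    have hquad : 0 < 2 * z.re * z.im * (1 + ((Complex.normSq z)⁻¹) ^ 2) := by positivity
    have hlin : 0 < (-1 - ξ) * z.im := mul_pos (by linarith) hv
    have hrest : 0 < -ξ * z.im * (Complex.normSq z)⁻¹ :=
      mul_pos (mul_pos (by linarith) hv) hr
    linarith
  · rw [Real.sin_two_mul, Complex.sin_arg, Complex.cos_arg hz]
    have : 0 < ‖z‖ := norm_pos_iff.mpr hz
    positivity
end

section
/- Let ξ < −1 be real, t > 0, x = 2tξ, and let ξ₂ < −1 be the stationary point of the phase. Then every z = ξ₂ + u + iv with u < 0 and 0 < v ≤ −u satisfies Re(2i·(t(z + 1)³ + (x + 2t)(z + 1))) ≤ −4t·u²·v. -/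
/-- The coefficient of the linear term is dominated by the square of the distance from the
stationary point to `-1`. -/
theorem three_mul_sq_add_linear_coeff_nonneg {ξ η ζ : ℝ} (hη : η < -2) (hζ : ζ < -1)
    (hηξ : η ^ 2 - ξ * η - 2 = 0) (hζη : ζ ^ 2 - η * ζ + 1 = 0) :
    0 ≤ 3 * (ζ + 1) ^ 2 + 2 * ξ + 2 := by
  have hbracket : -3 * η * ζ - 2 * η + 2 ≤ 0 := by nlinarith
  have hprod : 0 ≤ -η * (3 * (ζ + 1) ^ 2 + 2 * ξ + 2) := by
    have hfactor : -η * (3 * (ζ + 1) ^ 2 + 2 * ξ + 2) =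
        (η + 2) * (-3 * η * ζ - 2 * η + 2) := by
      linear_combination -3 * η * hζη + 2 * hηξ
    rw [hfactor]
    exact mul_nonneg_of_nonpos_of_nonpos (by linarith) hbracket
  exact nonneg_of_mul_nonneg_right hprod (by linarith)

theorem stmt_12 (ξ t : ℝ) (hξ : ξ < -1) (ht : 0 < t) :
    let x : ℝ := 2 * t * ξ
    let η₁ : ℝ := (ξ - Real.sqrt (ξ ^ 2 + 8)) / 2
    let ξ₂ : ℝ := (η₁ - Real.sqrt (η₁ ^ 2 - 4)) / 2
    ∀ u v : ℝ, u < 0 → 0 < v → v ≤ -u →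
      (2 * Complex.I *
          ((t : ℂ) * (((ξ₂ : ℂ) + (u : ℂ) + (v : ℂ) * Complex.I) + 1) ^ 3
            + ((x : ℂ) + 2 * (t : ℂ))
              * (((ξ₂ : ℂ) + (u : ℂ) + (v : ℂ) * Complex.I) + 1))).re
        ≤ -4 * t * u ^ 2 * v := by
  intro x η₁ ξ₂ u v hu hv hvu
  have hsqη : Real.sqrt (ξ ^ 2 + 8) ^ 2 = ξ ^ 2 + 8 := Real.sq_sqrt (by positivity)
  have hη : η₁ < -2 := by
    have : 4 + ξ < Real.sqrt (ξ ^ 2 + 8) := Real.lt_sqrt_of_sq_lt (by nlinarith)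
    simp only [η₁]
    linarith
  have hsqζ : Real.sqrt (η₁ ^ 2 - 4) ^ 2 = η₁ ^ 2 - 4 := Real.sq_sqrt (by nlinarith)
  have hζ : ξ₂ < -1 := by
    have := Real.sqrt_nonneg (η₁ ^ 2 - 4)
    simp only [ξ₂]
    linarith
  have hηξ : η₁ ^ 2 - ξ * η₁ - 2 = 0 := by
    simp only [η₁]
    linear_combination hsqη / 4
  have hζη : ξ₂ ^ 2 - η₁ * ξ₂ + 1 = 0 := by
    simp only [ξ₂]
    linear_combination hsqζ / 4
  have hcoeff := three_mul_sq_add_linear_coeff_nonneg hη hζ hηξ hζη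
  have hre : (2 * Complex.I *
      ((t : ℂ) * (((ξ₂ : ℂ) + (u : ℂ) + (v : ℂ) * Complex.I) + 1) ^ 3
        + ((x : ℂ) + 2 * (t : ℂ))
          * (((ξ₂ : ℂ) + (u : ℂ) + (v : ℂ) * Complex.I) + 1))).re
      = -2 * (t * v) * (3 * (ξ₂ + 1 + u) ^ 2 - v ^ 2 + 2 * ξ + 2) := by
    have hx : x = 2 * t * ξ := rfl
    clear_value x ξ₂
    subst hx
    simp [pow_succ]
    ring
  rw [hre]
  have hcross : 0 ≤ (ξ₂ + 1) * u := mul_nonneg_of_nonpos_of_nonpos (by linarith) hu.le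
  have hlower : 2 * u ^ 2 ≤ 3 * (ξ₂ + 1 + u) ^ 2 - v ^ 2 + 2 * ξ + 2 := by nlinarith
  nlinarith [mul_le_mul_of_nonneg_left hlower (mul_pos ht hv).le]
end

section
/- Let ν : (0, ∞) → ℝ be measurable with ν ∈ L¹((0, ∞)) and ζ ↦ ν(ζ)/ζ ∈ L¹((0, ∞)), and suppose ν(1/ζ) = ν(ζ) for all ζ > 0. Then for every complex z ∉ [0, ∞) (so that also 1/z ∉ [0, ∞)), one has ∫₀^∞ ν(ζ)·(1/(ζ − 1/z) − 1/(2ζ)) dζ = −∫₀^∞ ν(ζ)·(1/(ζ − z) − 1/(2ζ)) dζ. Consequently the function T(z) = exp(−i∫₀^∞ ν(ζ)(1/(ζ − z) − 1/(2ζ)) dζ) satisfies T(1/z) = T(z)⁻¹. -/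
open MeasureTheory

/-- Change of variables `y = 1 / x` on the positive half-line. -/
theorem integral_comp_one_div_Ioi {E : Type*} [NormedAddCommGroup E] [NormedSpace ℝ E]
    (g : ℝ → E) :
    ∫ x in Set.Ioi (0 : ℝ), (x ^ 2)⁻¹ • g (1 / x) = ∫ y in Set.Ioi (0 : ℝ), g y := by
  rw [← integral_comp_rpow_Ioi g (p := -1) (by norm_num)]
  refine setIntegral_congr_fun measurableSet_Ioi fun x hx => ?_
  have hx' : (0 : ℝ) ≤ x := le_of_lt hx
  have hexp : x ^ (-1 - 1 : ℝ) = (x ^ 2)⁻¹ := by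
    rw [show (-1 - 1 : ℝ) = -(2 : ℕ) by norm_num, Real.rpow_neg hx', Real.rpow_natCast]
  simp only [hexp, Real.rpow_neg_one, one_div, abs_neg, abs_one, one_mul]

theorem stmt_16 (ν : ℝ → ℝ) (hmeas : Measurable ν)
    (h1 : IntegrableOn ν (Set.Ioi 0))
    (h2 : IntegrableOn (fun ζ => ν ζ / ζ) (Set.Ioi 0))
    (hsym : ∀ ζ : ℝ, 0 < ζ → ν (1 / ζ) = ν ζ) :
    ∀ z : ℂ, (∀ x : ℝ, 0 ≤ x → z ≠ (x : ℂ)) →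
      (∫ ζ in Set.Ioi (0 : ℝ),
          (ν ζ : ℂ) * (1 / ((ζ : ℂ) - 1 / z) - 1 / (2 * (ζ : ℂ))))
        = -∫ ζ in Set.Ioi (0 : ℝ),
            (ν ζ : ℂ) * (1 / ((ζ : ℂ) - z) - 1 / (2 * (ζ : ℂ))) ∧
      Complex.exp (-Complex.I * ∫ ζ in Set.Ioi (0 : ℝ),
          (ν ζ : ℂ) * (1 / ((ζ : ℂ) - 1 / z) - 1 / (2 * (ζ : ℂ))))
        = (Complex.exp (-Complex.I * ∫ ζ in Set.Ioi (0 : ℝ),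
            (ν ζ : ℂ) * (1 / ((ζ : ℂ) - z) - 1 / (2 * (ζ : ℂ)))))⁻¹ := by
  intro z hz
  have hz0 : z ≠ 0 := by simpa using hz 0 le_rfl
  have key : (∫ ζ in Set.Ioi (0 : ℝ),
          (ν ζ : ℂ) * (1 / ((ζ : ℂ) - 1 / z) - 1 / (2 * (ζ : ℂ))))
        = -∫ ζ in Set.Ioi (0 : ℝ),
            (ν ζ : ℂ) * (1 / ((ζ : ℂ) - z) - 1 / (2 * (ζ : ℂ))) := by
    rw [← integral_comp_one_div_Ioi, ← integral_neg]
    refine setIntegral_congr_fun measurableSet_Ioi fun x hx => ?_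
    have hx' : (0 : ℝ) < x := hx
    have hx0 : (x : ℂ) ≠ 0 := by exact_mod_cast hx'.ne'
    have hxz : (x : ℂ) - z ≠ 0 := sub_ne_zero.2 (hz x hx'.le).symm
    have hzx : z - (x : ℂ) ≠ 0 := sub_ne_zero.2 (hz x hx'.le)
    have hinv : 1 / (1 / (x : ℂ) - 1 / z) = x * z / (z - x) := by
      rw [div_sub_div _ _ hx0 hz0, one_div_div, one_mul, mul_one]
    simp only [hsym x hx', Complex.real_smul]
    push_cast
    rw [hinv]
    field_simp
    ring
  refine ⟨key, ?_⟩
  rw [key, mul_neg, Complex.exp_neg]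
end

section
/- Let z₀, …, z_{N−1} be complex numbers with Im z_j > 0 for every j. Then z·(∏_{j=0}^{N−1} (z − z_j)/(z − conj(z_j)) − 1) tends to −2i·∑_{j=0}^{N−1} Im z_j as |z| → ∞ (i.e., along the cobounded filter on ℂ). In particular ∏_{j=0}^{N−1} (z − z_j)/(z − conj(z_j)) → 1 as |z| → ∞. -/
open Filter Bornology in
/-- If `z * (f z - 1)` converges as `z → ∞`, then `f z → 1`. -/
theorem tendsto_one_of_tendsto_mul_sub_one {𝕜 : Type*} [NormedField 𝕜] {f : 𝕜 → 𝕜} {c : 𝕜}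
    (hf : Tendsto (fun z => z * (f z - 1)) (cobounded 𝕜) (nhds c)) :
    Tendsto f (cobounded 𝕜) (nhds 1) := by
  have hlim : Tendsto (fun z => z⁻¹ * (z * (f z - 1)) + 1) (cobounded 𝕜) (nhds 1) := by
    simpa using (tendsto_inv₀_cobounded.mul hf).add_const 1
  refine hlim.congr' ?_
  filter_upwards [eventually_ne_cobounded (0 : 𝕜)] with z hz
  field_simp
  ring

open Filter Bornology in
theorem tendsto_mul_sub_div_sub_sub_one {𝕜 : Type*} [NormedField 𝕜] (a b : 𝕜) :
    Tendsto (fun z => z * ((z - a) / (z - b) - 1)) (cobounded 𝕜) (nhds (b - a)) := by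
  have hinv : Tendsto (fun z => (z - b)⁻¹) (cobounded 𝕜) (nhds 0) :=
    tendsto_inv₀_cobounded.comp (tendsto_sub_const_cobounded b)
  have hlim : Tendsto (fun z => (b - a) * (1 + b * (z - b)⁻¹)) (cobounded 𝕜) (nhds (b - a)) := by
    simpa using ((hinv.const_mul b).const_add 1).const_mul (b - a)
  refine hlim.congr' ?_
  filter_upwards [eventually_ne_cobounded b] with z hz
  have hzb : z - b ≠ 0 := sub_ne_zero.mpr hz
  field_simp
  ring

open Filter Bornology in
/-- The first-order coefficients at infinity of functions tending to `1` add under products. -/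
theorem tendsto_mul_prod_sub_one {𝕜 ι : Type*} [NormedField 𝕜] (s : Finset ι) (f : ι → 𝕜 → 𝕜)
    (c : ι → 𝕜)
    (hf : ∀ i ∈ s, Tendsto (fun z => z * (f i z - 1)) (cobounded 𝕜) (nhds (c i))) :
    Tendsto (fun z => z * (∏ i ∈ s, f i z - 1)) (cobounded 𝕜) (nhds (∑ i ∈ s, c i)) := by
  classical
  induction s using Finset.induction_on with
  | empty => simp [tendsto_const_nhds]
  | insert a s ha ih =>
    have hs := ih fun i hi => hf i (Finset.mem_insert_of_mem hi)
    have hlim := ((hf a (Finset.mem_insert_self a s)).mul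
      (tendsto_one_of_tendsto_mul_sub_one hs)).add hs
    rw [mul_one] at hlim
    rw [Finset.sum_insert ha]
    refine hlim.congr fun z => ?_
    rw [Finset.prod_insert ha]
    ring

theorem stmt_17 (N : ℕ) (zj : Fin N → ℂ) (h : ∀ j, 0 < (zj j).im) :
    Filter.Tendsto
      (fun z : ℂ =>
        z * ((∏ j, (z - zj j) / (z - (starRingEnd ℂ) (zj j))) - 1))
      (Bornology.cobounded ℂ)
      (nhds (-2 * Complex.I * ∑ j, ((zj j).im : ℂ))) ∧
    Filter.Tendsto
      (fun z : ℂ => ∏ j, (z - zj j) / (z - (starRingEnd ℂ) (zj j)))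
      (Bornology.cobounded ℂ) (nhds 1) := by
  have hlim := tendsto_mul_prod_sub_one Finset.univ
    (fun j z => (z - zj j) / (z - (starRingEnd ℂ) (zj j))) _
    fun j _ => tendsto_mul_sub_div_sub_sub_one (zj j) ((starRingEnd ℂ) (zj j))
  refine ⟨?_, tendsto_one_of_tendsto_mul_sub_one hlim⟩
  convert hlim using 2
  rw [Finset.mul_sum]
  refine Finset.sum_congr rfl fun j _ => ?_
  rw [← neg_sub, Complex.sub_conj]
  push_cast
  ring
end
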